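/- Let G be a finite 2-group which is a non-trivial OC-group. Then Z_3(G)/Z(G) is an elementary abelian group of order 4. -/

import Mathlib

namespace OCProof

open Subgroup

variable {G : Type} [Group G]

theorem ord4 {x : G} (hx : x ≠ 1) (h : x ^ 4 = 1) : orderOf x = 2 ∨ orderOf x = 4 := by
  have hd : orderOf x ∣ 2 ^ 2 := by
    have := orderOf_dvd_of_pow_eq_one h
    simpa using this
  obtain ⟨k, hk, he⟩ := (Nat.dvd_prime_pow Nat.prime_two).1 hd
  have h1 : orderOf x ≠ 1 := by simpa using hx
  interval_cases k <;> simp_all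

theorem ord8 {x : G} (hx : x ≠ 1) (h : x ^ 8 = 1) :
    orderOf x = 2 ∨ orderOf x = 4 ∨ orderOf x = 8 := by
  have hd : orderOf x ∣ 2 ^ 3 := by
    have := orderOf_dvd_of_pow_eq_one h
    simpa using this
  obtain ⟨k, hk, he⟩ := (Nat.dvd_prime_pow Nat.prime_two).1 hd
  have h1 : orderOf x ≠ 1 := by simpa using hx
  interval_cases k <;> simp_all

theorem ordEq4 {x : G} (hx : x ^ 2 ≠ 1) (h : x ^ 4 = 1) : orderOf x = 4 := by
  have := orderOf_eq_prime_pow (x := x) (n := 1) (p := 2) (by simpa using hx) (by simpa using h)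
  simpa using this

theorem ordEq8 {x : G} (hx : x ^ 4 ≠ 1) (h : x ^ 8 = 1) : orderOf x = 8 := by
  have := orderOf_eq_prime_pow (x := x) (n := 2) (p := 2) (by simpa using hx) (by simpa using h)
  simpa using this

theorem ne_one_of {x : G} {H : Subgroup G} (hx : x ∉ H) : x ≠ 1 := by
  rintro rfl; exact hx H.one_mem

/-- Elements in the second center that are noncentral are equal modulo the center. -/
theorem second_sq
    (hOC : ∀ x y : G, x ∉ center G → y ∉ center G → orderOf x = orderOf y → IsConj x y)
    {N M : Subgroup G} (hN : center G ≤ N)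
    (hM : ∀ x ∈ M, ∀ g : G, g * x * g⁻¹ * x⁻¹ ∈ N) {x y : G} (hx : x ∈ M)
    (hxz : x ∉ center G) (hyz : y ∉ center G) (ho : orderOf x = orderOf y) :
    y * x⁻¹ ∈ N := by
  obtain ⟨g, hg⟩ := isConj_iff.1 (hOC x y hxz hyz ho)
  have := hM x hx g
  rwa [hg] at this

theorem sq_mem
    (hOC : ∀ x y : G, x ∉ center G → y ∉ center G → orderOf x = orderOf y → IsConj x y)
    {N M : Subgroup G} (hN : center G ≤ N)
    (hM : ∀ x ∈ M, ∀ g : G, g * x * g⁻¹ * x⁻¹ ∈ N) {x : G} (hx : x ∈ M) :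
    x ^ 2 ∈ N := by
  by_cases hxz : x ∈ center G
  · exact hN (pow_mem hxz 2)
  · have h := second_sq hOC hN hM hx hxz (y := x⁻¹) (by simpa using hxz) (by simp)
    have := N.inv_mem h
    simpa [pow_two] using this

theorem second_pow4
    (hOC : ∀ x y : G, x ∉ center G → y ∉ center G → orderOf x = orderOf y → IsConj x y)
    {M : Subgroup G}
    (hM : ∀ x ∈ M, ∀ g : G, g * x * g⁻¹ * x⁻¹ ∈ center G) {x : G} (hx : x ∈ M)
    (hxz : x ∉ center G) : x ^ 4 = 1 := by
  have hsq : x ^ 2 ∈ center G := sq_mem hOC le_rfl hM hx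
  obtain ⟨g, hg⟩ := isConj_iff.1 (hOC x x⁻¹ hxz (by simpa using hxz) (by simp))
  have h1 : g * x ^ 2 * g⁻¹ = x ^ 2 := by
    rw [mem_center_iff.1 hsq g]; group
  have h2 : g * x ^ 2 * g⁻¹ = (x ^ 2)⁻¹ := by
    rw [← conj_pow, hg, inv_pow]
  rw [h1] at h2
  calc x ^ 4 = x ^ 2 * x ^ 2 := by group
    _ = (x ^ 2)⁻¹ * x ^ 2 := by rw [← h2]
    _ = 1 := by group

theorem center_pow4
    (hOC : ∀ x y : G, x ∉ center G → y ∉ center G → orderOf x = orderOf y → IsConj x y)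
    {M : Subgroup G} (hle : center G ≤ M)
    (hM : ∀ x ∈ M, ∀ g : G, g * x * g⁻¹ * x⁻¹ ∈ center G) {x : G} (hx : x ∈ M)
    (hxz : x ∉ center G) {z : G} (hz : z ∈ center G) : z ^ 4 = 1 := by
  have h1 := second_pow4 hOC hM hx hxz
  have h2 := second_pow4 hOC hM (M.mul_mem hx (hle hz))
    (fun h => hxz (((center G).mul_mem_cancel_right hz).1 h))
  have hc : Commute x z := mem_center_iff.1 hz x
  rw [hc.mul_pow, h1, one_mul] at h2
  exact h2

theorem second_coset
    (hOC : ∀ x y : G, x ∉ center G → y ∉ center G → orderOf x = orderOf y → IsConj x y)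
    {M : Subgroup G}
    (hM : ∀ x ∈ M, ∀ g : G, g * x * g⁻¹ * x⁻¹ ∈ center G) {x y : G} (hx : x ∈ M)
    (hxz : x ∉ center G) (hy : y ∈ M) (hyz : y ∉ center G) : y * x⁻¹ ∈ center G := by
  by_cases hxy : y * x ∈ center G
  · have hsq : x ^ 2 ∈ center G := sq_mem hOC le_rfl hM hx
    have := (center G).mul_mem hxy ((center G).inv_mem hsq)
    have e : y * x * (x ^ 2)⁻¹ = y * x⁻¹ := by group
    rwa [e] at this
  · have ox := ord4 (ne_one_of hxz) (second_pow4 hOC hM hx hxz)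
    have oy := ord4 (ne_one_of hyz) (second_pow4 hOC hM hy hyz)
    have oxy := ord4 (ne_one_of hxy) (second_pow4 hOC hM (M.mul_mem hy hx) hxy)
    have h1 : orderOf x ≠ orderOf (y * x) := fun h => by
      have := second_sq hOC le_rfl hM hx hxz hxy h
      rw [mul_inv_cancel_right] at this
      exact hyz this
    have h2 : orderOf y ≠ orderOf (y * x) := fun h => by
      have := second_sq hOC le_rfl hM hy hyz hxy h
      have h3 := hM (y * x * y⁻¹) (M.mul_mem (M.mul_mem hy hx) (M.inv_mem hy)) y⁻¹
      have h4 := (Subgroup.center G).mul_mem h3 this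
      have e : y⁻¹ * (y * x * y⁻¹) * y⁻¹⁻¹ * (y * x * y⁻¹)⁻¹ * (y * x * y⁻¹) = x := by group
      rw [e] at h4
      exact hxz h4
    exact second_sq hOC le_rfl hM hx hxz hyz (by omega)

theorem third_coset
    (hOC : ∀ x y : G, x ∉ center G → y ∉ center G → orderOf x = orderOf y → IsConj x y)
    {M K : Subgroup G} (hle : center G ≤ M)
    (hM : ∀ x ∈ M, ∀ g : G, g * x * g⁻¹ * x⁻¹ ∈ center G)
    (hK : ∀ x ∈ K, ∀ g : G, g * x * g⁻¹ * x⁻¹ ∈ M) {x : G} (hx : x ∈ M)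
    (hxz : x ∉ center G) {y w : G} (hy : y ∈ K) (hyM : y ∉ M) (hw : w ∈ K) (hwM : w ∉ M) :
    w * y⁻¹ ∈ M := by
  have p4 : ∀ a ∈ M, a ^ 4 = 1 := fun a ha => by
    by_cases haz : a ∈ center G
    · exact center_pow4 hOC hle hM hx hxz haz
    · exact second_pow4 hOC hM ha haz
  have nz : ∀ a, a ∉ M → a ∉ center G := fun a ha h => ha (hle h)
  have ord : ∀ a ∈ K, a ∉ M → (orderOf a = 2 ∨ orderOf a = 4 ∨ orderOf a = 8) ∧
      orderOf a ≠ orderOf x := fun a ha haM => by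
    refine ⟨ord8 (ne_one_of haM) ?_, fun h => ?_⟩
    · have := p4 _ (sq_mem hOC hle hK ha)
      rwa [← pow_mul] at this
    · have := second_sq hOC le_rfl hM hx hxz (nz a haM) h.symm
      exact haM (by simpa using M.mul_mem (hle this) hx)
  by_cases hwy : w * y ∈ M
  · have hsq : y ^ 2 ∈ M := sq_mem hOC hle hK hy
    have := M.mul_mem hwy (M.inv_mem hsq)
    have e : w * y * (y ^ 2)⁻¹ = w * y⁻¹ := by group
    rwa [e] at this
  · have ox := ord4 (ne_one_of hxz) (second_pow4 hOC hM hx hxz)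
    have o1 := ord y hy hyM
    have o2 := ord w hw hwM
    have o3 := ord (w * y) (K.mul_mem hw hy) hwy
    have h1 : orderOf y ≠ orderOf (w * y) := fun h => by
      have := second_sq hOC hle hK hy (nz _ hyM) (nz _ hwy) h
      rw [mul_inv_cancel_right] at this
      exact hwM this
    have h2 : orderOf w ≠ orderOf (w * y) := fun h => by
      have := second_sq hOC hle hK hw (nz _ hwM) (nz _ hwy) h
      have h3 := hK (w * y * w⁻¹) (K.mul_mem (K.mul_mem hw hy) (K.inv_mem hw)) w⁻¹
      have h4 := M.mul_mem h3 this
      have e : w⁻¹ * (w * y * w⁻¹) * w⁻¹⁻¹ * (w * y * w⁻¹)⁻¹ * (w * y * w⁻¹) = y := by group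
      rw [e] at h4
      exact hyM h4
    exact second_sq hOC hle hK hy (nz _ hyM) (nz _ hwM) (by omega)

theorem third_sq [Finite G] (hG2 : IsPGroup 2 G)
    (hOC : ∀ x y : G, x ∉ center G → y ∉ center G → orderOf x = orderOf y → IsConj x y)
    {M K : Subgroup G} (hle : center G ≤ M) (hMK : M ≤ K)
    (hM : ∀ x ∈ M, ∀ g : G, g * x * g⁻¹ * x⁻¹ ∈ center G)
    (hK : ∀ x ∈ K, ∀ g : G, g * x * g⁻¹ * x⁻¹ ∈ M) {y : G} (hy : y ∈ K) (hyM : y ∉ M) :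
    y ^ 2 ∈ center G := by
  by_contra hx
  have hxM : y ^ 2 ∈ M := sq_mem hOC hle hK hy
  have hyz : y ∉ center G := fun h => hyM (hle h)
  have z4 : ∀ z ∈ center G, z ^ 4 = 1 := fun z hz => center_pow4 hOC hle hM hxM hx hz
  have y8 : y ^ 8 = 1 := by
    have := second_pow4 hOC hM hxM hx
    rwa [← pow_mul] at this
  have y4z : y ^ 4 ∈ center G := by
    have := sq_mem hOC le_rfl hM hxM
    rwa [← pow_mul] at this
  have formM : ∀ w ∈ M, ∃ z ∈ center G, w = z ∨ w = z * y ^ 2 := fun w hw => by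
    by_cases hwz : w ∈ center G
    · exact ⟨w, hwz, Or.inl rfl⟩
    · exact ⟨w * (y ^ 2)⁻¹, second_coset hOC hM hxM hx hw hwz, Or.inr (by group)⟩
  have formK : ∀ w ∈ K, ∃ z ∈ center G, ∃ i : ℕ, w = z * y ^ i := fun w hw => by
    by_cases hwM : w ∈ M
    · obtain ⟨z, hz, h | h⟩ := formM w hwM
      · exact ⟨z, hz, 0, by simpa using h⟩
      · exact ⟨z, hz, 2, h⟩
    · obtain ⟨z, hz, h | h⟩ := formM _ (third_coset hOC hle hM hK hxM hx hy hyM hw hwM)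
      · exact ⟨z, hz, 1, by rw [← h]; group⟩
      · refine ⟨z, hz, 3, ?_⟩
        rw [eq_comm, pow_succ, ← mul_assoc, ← h]; group
  -- y has order eight
  have y4 : y ^ 4 ≠ 1 := fun y4 => by
    by_cases hel : ∀ z ∈ center G, z ^ 2 = 1
    · apply hx
      rw [mem_center_iff]
      intro g
      obtain ⟨z, hz, hc⟩ := formM _ (hK y hy g)
      have hcomm : ∀ a : G, Commute z a := fun a => (mem_center_iff.1 hz a).symm
      have key : (g * y * g⁻¹) ^ 2 = y ^ 2 := by
        rcases hc with hc | hc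
        · have e : g * y * g⁻¹ = z * y := by rw [← hc]; group
          rw [e, (hcomm y).mul_pow, hel z hz, one_mul]
        · have e : g * y * g⁻¹ = z * y ^ 3 := by
            rw [pow_succ, ← mul_assoc, ← hc]; group
          rw [e, (hcomm _).mul_pow, hel z hz, one_mul, ← pow_mul]
          calc y ^ (3 * 2) = y ^ 4 * y ^ 2 := by rw [← pow_add]
            _ = y ^ 2 := by rw [y4, one_mul]
      rw [conj_pow] at key
      exact mul_inv_eq_iff_eq_mul.1 key
    · push Not at hel
      obtain ⟨z, hz, hz2⟩ := hel
      have hcomm : Commute z (y ^ 2) := (mem_center_iff.1 hz _).symm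
      have hnz : z * y ^ 2 ∉ center G := fun h => hx (((center G).mul_mem_cancel_left hz).1 h)
      have o1 : orderOf (z * y ^ 2) = 4 := by
        apply ordEq4
        · rw [hcomm.mul_pow, ← pow_mul, y4, mul_one]; exact hz2
        · rw [hcomm.mul_pow, ← pow_mul, y8, mul_one]; exact z4 z hz
      have o2 : orderOf y = 4 := ordEq4 (ne_one_of hx) y4
      have hm : z * y ^ 2 ∈ M := M.mul_mem (hle hz) hxM
      have := second_sq hOC le_rfl hM hm hnz hyz (o1.trans o2.symm)
      have h9 := M.mul_mem (hle this) hm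
      rw [inv_mul_cancel_right] at h9
      exact hyM h9
  have oy : orderOf y = 8 := ordEq8 y4 y8
  have oy2 : orderOf (y ^ 2) = 4 := by
    apply ordEq4
    · rwa [← pow_mul]
    · rwa [← pow_mul]
  -- conjugates of elements of `K` lie in `K`
  have conjK : ∀ w ∈ K, ∀ g : G, g * w * g⁻¹ ∈ K := fun w hw g => by
    simpa using K.mul_mem (hMK (hK w hw g)) hw
  have zcomm : ∀ z ∈ center G, ∀ a : G, Commute z a :=
    fun z hz a => (mem_center_iff.1 hz a).symm
  -- elements not commuting with y are involutions
  have inv : ∀ g : G, ¬ Commute g y → orderOf g = 2 := fun g hg => by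
    have hgz : g ∉ center G := fun h => hg (zcomm g h y)
    obtain ⟨k, hk⟩ := IsPGroup.iff_orderOf.1 hG2 g
    rcases Nat.lt_or_ge k 3 with hk3 | hk3
    · interval_cases k
      · exact absurd (by simpa using hk) (ne_one_of hgz)
      · simpa using hk
      · exfalso
        obtain ⟨c, hc⟩ := isConj_iff.1 (hOC (y ^ 2) g hx hgz (by rw [oy2, hk]; norm_num))
        obtain ⟨z, hz, i, hi⟩ := formK g (hc ▸ conjK _ (hMK hxM) c)
        apply hg
        rw [hi]
        exact (zcomm z hz y).mul_left (Commute.pow_self y i)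
    · exfalso
      have hd : 8 ∣ orderOf g := by
        rw [hk]
        exact pow_dvd_pow 2 hk3
      have ho := orderOf_pow_orderOf_div (orderOf_pos g).ne' hd
      set u := g ^ (orderOf g / 8) with hu
      have hgu : Commute g u := Commute.self_pow g _
      have huz : u ∉ center G := fun h => by
        have := orderOf_dvd_of_pow_eq_one (z4 u h)
        rw [ho] at this
        revert this; decide
      obtain ⟨c, hc⟩ := isConj_iff.1 (hOC y u hyz huz (by rw [oy, ho]))
      obtain ⟨z, hz, i, hi⟩ := formK u (hc ▸ conjK _ hy c)
      have hgi : Commute g (y ^ i) := by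
        have e : y ^ i = z⁻¹ * u := by rw [hi]; group
        rw [e]
        exact ((zcomm z hz g).symm.inv_right).mul_right hgu
      rcases Nat.even_or_odd' i with ⟨j, hj | hj⟩
      · -- then u ^ 4 = 1
        have hu4 : u ^ 4 = 1 := by
          rw [hi, (zcomm z hz _).mul_pow, z4 z hz, one_mul, hj, ← pow_mul,
            show 2 * j * 4 = 8 * j by ring, pow_mul, y8, one_pow]
        have := orderOf_dvd_of_pow_eq_one hu4
        rw [ho] at this
        revert this; decide
      · apply hg
        have e : (y ^ i) ^ i = y := by
          rw [← pow_mul, hj]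
          have : (2 * j + 1) * (2 * j + 1) = 8 * ((j * (j + 1)) / 2) + 1 := by
            have := Nat.div_mul_cancel (Nat.even_mul_succ_self j).two_dvd
            nlinarith
          rw [this, pow_succ, pow_mul, y8, one_pow, one_mul]
        have := hgi.pow_right i
        rwa [e] at this
  obtain ⟨g, hg⟩ := isConj_iff.1 (hOC y y⁻¹ hyz (by simpa using hyz) (by simp))
  have o5 : orderOf (y ^ 5) = 8 := by
    rw [Nat.Coprime.orderOf_pow]
    · exact oy
    · rw [oy]; decide
  have h5z : y ^ 5 ∉ center G := fun h => hyz (by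
    have : y ^ 5 = y ^ 4 * y := pow_succ y 4
    rw [this] at h
    exact ((center G).mul_mem_cancel_left y4z).1 h)
  obtain ⟨h, hh⟩ := isConj_iff.1 (hOC y (y ^ 5) hyz h5z (by rw [oy, o5]))
  have hgc : ¬ Commute g y := fun hc => by
    rw [hc.eq, mul_inv_cancel_right] at hg
    apply ne_one_of hx
    rw [pow_two]; nth_rewrite 1 [hg]; simp
  have hhc : ¬ Commute h y := fun hc => by
    rw [hc.eq, mul_inv_cancel_right, pow_succ] at hh
    exact y4 (by simpa using hh.symm)
  have hgz : g ∉ center G := fun h' => hgc (zcomm g h' y)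
  have hhz : h ∉ center G := fun h' => hhc (zcomm h h' y)
  obtain ⟨k, hk⟩ := isConj_iff.1 (hOC h g hhz hgz (by rw [inv h hhc, inv g hgc]))
  obtain ⟨z, hz, i, hi⟩ := formK _ (conjK y hy k⁻¹)
  have e1 : h * (z * y ^ i) * h⁻¹ = (y ^ 4) ^ i * (z * y ^ i) := by
    calc h * (z * y ^ i) * h⁻¹ = z * (h * y ^ i * h⁻¹) := by
          rw [← mul_assoc, ← (zcomm z hz h).eq]; group
      _ = z * (y ^ 4 * y) ^ i := by rw [← conj_pow, hh, pow_succ]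
      _ = z * ((y ^ 4) ^ i * y ^ i) := by rw [(Commute.pow_self y 4).mul_pow]
      _ = (y ^ 4) ^ i * (z * y ^ i) := by
          rw [← mul_assoc, (zcomm z hz _).eq, mul_assoc]
  have hyi : (y ^ 4) ^ i ∈ center G := pow_mem y4z i
  have e2 : g * y * g⁻¹ = (y ^ 4) ^ i * y := by
    calc g * y * g⁻¹ = k * (h * (k⁻¹ * y * k⁻¹⁻¹) * h⁻¹) * k⁻¹ := by rw [← hk]; group
      _ = k * ((y ^ 4) ^ i * (k⁻¹ * y * k⁻¹⁻¹)) * k⁻¹ := by rw [hi, e1]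
      _ = (y ^ 4) ^ i * k * (k⁻¹ * y * k⁻¹⁻¹) * k⁻¹ := by
          rw [(zcomm _ hyi k).eq]; simp only [mul_assoc]
      _ = (y ^ 4) ^ i * y := by simp only [mul_assoc, mul_inv_cancel_left, inv_inv,
            mul_inv_cancel, mul_one]
  rw [hg] at e2
  apply hx
  have e3 : y ^ 2 = ((y ^ 4) ^ i)⁻¹ := by
    rw [eq_inv_iff_mul_eq_one, ← (zcomm _ hyi _).eq, pow_two, ← mul_assoc, ← e2, inv_mul_cancel]
  rw [e3]
  exact inv_mem hyi

theorem main [Finite G] (hG2 : IsPGroup 2 G)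
    (hOC : ∀ x y : G, x ∉ center G → y ∉ center G → orderOf x = orderOf y → IsConj x y)
    {M K : Subgroup G} (hle : center G ≤ M) (hMK : M ≤ K)
    (hM : ∀ x ∈ M, ∀ g : G, g * x * g⁻¹ * x⁻¹ ∈ center G)
    (hK : ∀ x ∈ K, ∀ g : G, g * x * g⁻¹ * x⁻¹ ∈ M)
    {x y : G} (hx : x ∈ M) (hxz : x ∉ center G) (hy : y ∈ K) (hyM : y ∉ M) :
    Nat.card (Subgroup.map (QuotientGroup.mk' (Subgroup.center G)) K) = 4 ∧
    (∀ a b : Subgroup.map (QuotientGroup.mk' (Subgroup.center G)) K, a * b = b * a) ∧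
    (∀ a : Subgroup.map (QuotientGroup.mk' (Subgroup.center G)) K, a ^ 2 = 1) := by
  have hsq : ∀ w ∈ K, w ^ 2 ∈ center G := fun w hw => by
    by_cases hwM : w ∈ M
    · exact sq_mem hOC le_rfl hM hwM
    · exact third_sq hG2 hOC hle hMK hM hK hw hwM
  have h2 : ∀ a : Subgroup.map (QuotientGroup.mk' (Subgroup.center G)) K, a ^ 2 = 1 := by
    rintro ⟨_, w, hw, rfl⟩
    apply Subtype.ext
    change (QuotientGroup.mk' (center G) w) ^ 2 = 1
    rw [← map_pow]
    exact (QuotientGroup.eq_one_iff _).2 (hsq w hw)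
  refine ⟨?_, fun a b => ?_, h2⟩
  · let q := QuotientGroup.mk' (center G)
    have qe : ∀ a b : G, q a = q b ↔ a * b⁻¹ ∈ center G := fun a b => by
      rw [← mul_inv_eq_one, ← map_inv, ← map_mul]
      exact QuotientGroup.eq_one_iff _
    have hset : ((Subgroup.map q K : Subgroup (G ⧸ center G)) : Set (G ⧸ center G)) =
        {q 1, q x, q y, q (x * y)} := by
      ext a
      simp only [Set.mem_insert_iff, Set.mem_singleton_iff]
      constructor
      · rintro ⟨w, hw, rfl⟩
        by_cases hwz : w ∈ center G
        · left; rw [qe]; simpa using hwz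
        by_cases hwM : w ∈ M
        · right; left; rw [qe]; exact second_coset hOC hM hx hxz hwM hwz
        have hm := third_coset hOC hle hM hK hx hxz hy hyM hw hwM
        by_cases hmz : w * y⁻¹ ∈ center G
        · right; right; left; rw [qe]; exact hmz
        · right; right; right; rw [qe]
          have := second_coset hOC hM hx hxz hm hmz
          rwa [mul_inv_rev, ← mul_assoc]
      · have hxK := hMK hx
        rintro (rfl | rfl | rfl | rfl)
        · exact ⟨1, K.one_mem, rfl⟩
        · exact ⟨x, hxK, rfl⟩
        · exact ⟨y, hy, rfl⟩
        · exact ⟨x * y, K.mul_mem hxK hy, rfl⟩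
    have d1 : q 1 ≠ q x := fun h => hxz (by rw [qe] at h; simpa using h)
    have d2 : q 1 ≠ q y := fun h => hyM (hle (by rw [qe] at h; simpa using h))
    have d3 : q 1 ≠ q (x * y) := fun h => hyM (by
      rw [qe, one_mul, inv_mem_iff] at h
      exact (M.mul_mem_cancel_left hx).1 (hle h))
    have d4 : q x ≠ q y := fun h => hyM (by
      rw [qe] at h
      exact inv_mem_iff.1 ((M.mul_mem_cancel_left hx).1 (hle h)))
    have d5 : q x ≠ q (x * y) := fun h => hyM (by
      rw [map_mul, left_eq_mul] at h
      exact hle ((QuotientGroup.eq_one_iff _).1 h))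
    have d6 : q y ≠ q (x * y) := fun h => hxz (by
      rw [map_mul, right_eq_mul] at h
      exact (QuotientGroup.eq_one_iff _).1 h)
    change Nat.card ((Subgroup.map q K : Subgroup (G ⧸ center G)) : Set (G ⧸ center G)) = 4
    rw [hset, Nat.card_coe_set_eq, Set.ncard_insert_of_notMem (by simp [-map_one, -map_mul, d1, d2, d3]),
      Set.ncard_insert_of_notMem (by simp [-map_one, -map_mul, d4, d5]), Set.ncard_pair d6]
  · have i : ∀ c : Subgroup.map (QuotientGroup.mk' (Subgroup.center G)) K, c⁻¹ = c :=
      fun c => inv_eq_of_mul_eq_one_left (by rw [← pow_two]; exact h2 c)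
    rw [← i (a * b), mul_inv_rev, i, i]

theorem step (n : ℕ) : ∀ x ∈ Subgroup.upperCentralSeries G (n + 1), ∀ g : G,
    g * x * g⁻¹ * x⁻¹ ∈ Subgroup.upperCentralSeries G n := fun x hx g => by
  have := inv_mem (Subgroup.mem_upperCentralSeries_succ_iff.1 hx g)
  rwa [commutatorElement_inv] at this

theorem strict [Group.IsNilpotent G] (n : ℕ) (hn : Subgroup.upperCentralSeries G n ≠ ⊤) :
    ∃ x ∈ Subgroup.upperCentralSeries G (n + 1), x ∉ Subgroup.upperCentralSeries G n := by
  by_contra hcon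
  push Not at hcon
  have hall : ∀ m, Subgroup.upperCentralSeries G (n + m) ≤ Subgroup.upperCentralSeries G n := by
    intro m
    induction m with
    | zero => exact le_rfl
    | succ m ih =>
      intro x hx
      apply hcon
      rw [Subgroup.mem_upperCentralSeries_succ_iff]
      intro g
      exact ih (Subgroup.mem_upperCentralSeries_succ_iff.1 hx g)
  obtain ⟨c, hc⟩ := Group.IsNilpotent.nilpotent G
  apply hn
  rw [eq_top_iff, ← hc]
  exact (Subgroup.upperCentralSeries_mono G (Nat.le_add_left c n)).trans (hall c)

end OCProof


/-- **Claim 6 in Lemma 2.6.** Let `G` be a finite 2-group which is a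
non-trivial OC-group.  Then `Z₃(G) / Z(G)` (the image of the third center in
`G / Z(G)`) is an elementary abelian group of order `4`. -/
theorem third_center_mod_center_elementary_abelian (G : Type) [Group G] [Finite G]
    (hG2 : IsPGroup 2 G)
    (hOC : ∀ x y : G, x ∉ Subgroup.center G → y ∉ Subgroup.center G →
      orderOf x = orderOf y → IsConj x y)
    (h1 : ⊥ < Subgroup.center G) (h2 : Subgroup.center G < ⊤) :
    Nat.card
        (Subgroup.map (QuotientGroup.mk' (Subgroup.center G)) (upperCentralSeries G 3))
      = 4 ∧
    (∀ a b : Subgroup.map (QuotientGroup.mk' (Subgroup.center G)) (upperCentralSeries G 3),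
      a * b = b * a) ∧
    (∀ a : Subgroup.map (QuotientGroup.mk' (Subgroup.center G)) (upperCentralSeries G 3),
      a ^ 2 = 1) := by
  haveI : Fact (Nat.Prime 2) := ⟨Nat.prime_two⟩
  haveI : Group.IsNilpotent G := hG2.isNilpotent
  have e1 : Subgroup.upperCentralSeries G 1 = Subgroup.center G :=
    Subgroup.upperCentralSeries_one G
  have hM := OCProof.step (G := G) 1
  have hK := OCProof.step (G := G) 2
  have hle := Subgroup.upperCentralSeries_mono G (show 1 ≤ 2 by norm_num)
  have hMK := Subgroup.upperCentralSeries_mono G (show 2 ≤ 3 by norm_num)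
  obtain ⟨x, hx, hxz⟩ := OCProof.strict (G := G) 1 (by rw [e1]; exact h2.ne)
  rw [e1] at hM hle hxz
  have hne : Subgroup.upperCentralSeries G 2 ≠ ⊤ := by
    intro htop
    apply hxz
    rw [Subgroup.mem_center_iff]
    intro g
    by_cases hg : g ∈ Subgroup.center G
    · exact (Subgroup.mem_center_iff.1 hg x).symm
    · have h := OCProof.second_coset hOC hM hx hxz (y := g) (by rw [htop]; trivial) hg
      have h' := Subgroup.mem_center_iff.1 h x
      rw [inv_mul_cancel_right] at h'
      rw [← mul_assoc] at h'
      exact (mul_inv_eq_iff_eq_mul.1 h').symm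
  obtain ⟨y, hy, hyM⟩ := OCProof.strict (G := G) 2 hne
  exact OCProof.main hG2 hOC hle hMK hM hK hx hxz hy hyM
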